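/- Let d ≥ 1, γ ∈ (0, 3/4), and let F ∈ L¹_loc(ℂ^d) satisfy ∫_{ℂ^d} |F(z)| e^{−γ|z|²} dλ(z) < ∞. Then for every analytic polynomial G on ℂ^d (a finite linear combination of the monomials z^α = z₁^{α₁}⋯z_d^{α_d}, α ∈ ℕ^d), all the pairings below are absolutely convergent and (F, G)_{B²} = (F, Π_A G)_{B²} = (Π_A F, G)_{B²}. -/

import Mathlib

open MeasureTheory Filter
open scoped ENNReal

noncomputable section

/-- `ℂ^d`, identified with `ℝ^{2d}`, with the Euclidean norm. -/
abbrev CSp (d : ℕ) := EuclideanSpace ℂ (Fin d)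

instance {d : ℕ} : InnerProductSpace ℝ (CSp d) := InnerProductSpace.complexToReal
instance {d : ℕ} : MeasurableSpace (CSp d) := borel _
instance {d : ℕ} : BorelSpace (CSp d) := ⟨rfl⟩

/-- The pairing `(z,w) = ∑ z_j conj(w_j)`. -/
def pairB {d : ℕ} (z w : CSp d) : ℂ := ∑ j, z j * (starRingEnd ℂ) (w j)

/-- The density of the Gaussian measure `dμ = π^{−d} e^{−|z|²} dλ`. -/
def gaussW (d : ℕ) (w : CSp d) : ℝ := (Real.pi ^ d)⁻¹ * Real.exp (-‖w‖ ^ 2)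

/-- The Bargmann projection `(Π_A F)(z) = ∫ F(w) e^{(z,w)} dμ(w)`. -/
def PiA (d : ℕ) (F : CSp d → ℂ) (z : CSp d) : ℂ :=
  ∫ w : CSp d, F w * Complex.exp (pairB z w) * Complex.ofReal (gaussW d w)

/-- `P` is an analytic polynomial: a finite linear combination of monomials `z^α`. -/
def IsAnalyticPoly {d : ℕ} (P : CSp d → ℂ) : Prop :=
  ∃ (s : Finset (Fin d → ℕ)) (coef : (Fin d → ℕ) → ℂ),
    ∀ z : CSp d, P z = ∑ α ∈ s, coef α * ∏ j, (z j) ^ (α j)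

/-- The pairing `(F,G)_{B²} = ∫ F(z) conj(G(z)) dμ(z)`. -/
def BPair {d : ℕ} (F G : CSp d → ℂ) : ℂ :=
  ∫ z : CSp d, F z * (starRingEnd ℂ) (G z) * Complex.ofReal (gaussW d z)

lemma integrable_exp_neg_mul_sq_norm (d : ℕ) {b : ℝ} (hb : 0 < b) :
    Integrable (fun z : CSp d => Real.exp (-b * ‖z‖ ^ 2)) := by
  have h := (GaussianFourier.integrable_cexp_neg_mul_sq_norm_add (b := (b : ℂ)) (by simpa using hb)
    0 (0 : CSp d)).norm
  refine h.congr (.of_forall fun z => ?_)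
  simp only [Complex.norm_exp]
  congr 1
  simp [← Complex.ofReal_pow]

lemma integral_exp_neg_sq_norm (d : ℕ) :
    ∫ z : CSp d, Real.exp (-‖z‖ ^ 2) = Real.pi ^ d := by
  have h := GaussianFourier.integral_rexp_neg_mul_sq_norm (V := CSp d) one_pos
  have hrank : Module.finrank ℝ (CSp d) = 2 * d := by
    rw [← Module.finrank_mul_finrank ℝ ℂ (CSp d)]
    simp
  rw [hrank] at h
  simpa using h

lemma measurePreserving_smul_of_norm_eq_one {d : ℕ} {c : ℂ} (hc : ‖c‖ = 1) :
    MeasurePreserving (fun z : CSp d => c • z) := by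
  have hc0 : c ≠ 0 := by
    rintro rfl
    simp at hc
  let e : CSp d ≃ₗᵢ[ℝ] CSp d :=
    ⟨(LinearEquiv.smulOfNeZero ℂ (CSp d) c hc0).restrictScalars ℝ,
      fun z => by simp [norm_smul, hc]⟩
  exact e.measurePreserving

lemma norm_pairB_le {d : ℕ} (z w : CSp d) : ‖pairB z w‖ ≤ ‖z‖ * ‖w‖ := by
  have h : pairB z w = inner ℂ w z := by
    simp [pairB, PiLp.inner_apply]
  rw [h, mul_comm]
  exact norm_inner_le_norm w z

lemma conj_pairB {d : ℕ} (z w : CSp d) : (starRingEnd ℂ) (pairB z w) = pairB w z := by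
  simp [pairB, mul_comm]

lemma pairB_self {d : ℕ} (z : CSp d) : pairB z z = ((‖z‖ ^ 2 : ℝ) : ℂ) := by
  simp [pairB, EuclideanSpace.norm_sq_eq, Complex.mul_conj, Complex.normSq_eq_norm_sq]

lemma pairB_add_right {d : ℕ} (z u w : CSp d) : pairB z (u + w) = pairB z u + pairB z w := by
  simp [pairB, mul_add, Finset.sum_add_distrib]

lemma pairB_add_left {d : ℕ} (z u w : CSp d) : pairB (z + u) w = pairB z w + pairB u w := by
  simp [pairB, add_mul, Finset.sum_add_distrib]

lemma differentiable_pairB_left {d : ℕ} (w : CSp d) : Differentiable ℂ (fun z => pairB z w) := by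
  unfold pairB
  fun_prop

lemma continuous_pairB {d : ℕ} : Continuous (fun p : CSp d × CSp d => pairB p.1 p.2) := by
  unfold pairB
  fun_prop

lemma continuous_gaussW (d : ℕ) : Continuous (gaussW d) := by
  unfold gaussW
  fun_prop

lemma gaussW_nonneg {d : ℕ} (w : CSp d) : 0 ≤ gaussW d w := by
  unfold gaussW
  positivity

lemma norm_exp_pairB_le {d : ℕ} {a : ℝ} (ha : 0 < a) (z w : CSp d) :
    ‖Complex.exp (pairB z w)‖ ≤ Real.exp (a * ‖z‖ ^ 2 + ‖w‖ ^ 2 / (4 * a)) := by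
  rw [Complex.norm_exp]
  refine Real.exp_le_exp.2 (((Complex.re_le_norm _).trans (norm_pairB_le z w)).trans ?_)
  have h : a * ‖z‖ ^ 2 + ‖w‖ ^ 2 / (4 * a) - ‖z‖ * ‖w‖ = (2 * a * ‖z‖ - ‖w‖) ^ 2 / (4 * a) := by
    field_simp
    ring
  have h' : 0 ≤ (2 * a * ‖z‖ - ‖w‖) ^ 2 / (4 * a) := by positivity
  linarith

lemma integrable_mul_exp_neg_sq_norm {d : ℕ} {h : CSp d → ℂ} (hh : Continuous h) {C a : ℝ}
    {b : ℝ} (hab : a < b) (hbound : ∀ u, ‖h u‖ ≤ C * Real.exp (a * ‖u‖ ^ 2)) :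
    Integrable (fun u => h u * Complex.ofReal (Real.exp (-b * ‖u‖ ^ 2))) := by
  refine ((integrable_exp_neg_mul_sq_norm d (sub_pos.2 hab)).const_mul C).mono'
    (by fun_prop) (.of_forall fun u => ?_)
  rw [norm_mul, Complex.norm_real, Real.norm_of_nonneg (Real.exp_nonneg _)]
  calc _ ≤ C * Real.exp (a * ‖u‖ ^ 2) * Real.exp (-b * ‖u‖ ^ 2) := by gcongr; exact hbound u
    _ = _ := by
      rw [mul_assoc, ← Real.exp_add]
      ring_nf

/-- The mean value property of entire functions on `ℂ^d` against the radial Gaussian weight. -/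
lemma integral_mul_exp_neg_sq_norm_of_differentiable {d : ℕ} {h : CSp d → ℂ}
    (hh : Differentiable ℂ h) {C a : ℝ} (ha : a < 1)
    (hbound : ∀ u, ‖h u‖ ≤ C * Real.exp (a * ‖u‖ ^ 2)) :
    ∫ u, h u * Complex.ofReal (Real.exp (-‖u‖ ^ 2)) = h 0 * Complex.ofReal (Real.pi ^ d) := by
  have hcont : Continuous h := hh.continuous
  have hrot (θ : ℝ) : ∫ u, h (circleMap 0 1 θ • u) * Complex.ofReal (Real.exp (-‖u‖ ^ 2)) =
      ∫ u, h u * Complex.ofReal (Real.exp (-‖u‖ ^ 2)) := by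
    have hc : ‖circleMap 0 1 θ‖ = 1 := by simp
    have hmp := measurePreserving_smul_of_norm_eq_one (d := d) hc
    have hemb : MeasurableEmbedding (fun z : CSp d => circleMap 0 1 θ • z) :=
      measurableEmbedding_const_smul₀ (by intro h0; simp [h0] at hc)
    rw [← hmp.integral_comp hemb (fun u => h u * Complex.ofReal (Real.exp (-‖u‖ ^ 2)))]
    simp only [norm_smul, hc, one_mul]
  have hmean (u : CSp d) : ∫ θ in (0 : ℝ)..2 * Real.pi, h (circleMap 0 1 θ • u) =
      (2 * Real.pi : ℝ) • h 0 := by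
    have hd : Differentiable ℂ (fun t : ℂ => h (t • u)) := by fun_prop
    have hav := hd.diffContOnCl.circleAverage (c := 0) (R := 1)
    rw [Real.circleAverage_def] at hav
    simp only [zero_smul] at hav
    rw [← hav, smul_smul, mul_inv_cancel₀ (by positivity), one_smul]
  have hswap : ∫ θ in (0 : ℝ)..2 * Real.pi, ∫ u : CSp d,
        h (circleMap 0 1 θ • u) * Complex.ofReal (Real.exp (-‖u‖ ^ 2)) =
      ∫ u : CSp d, ∫ θ in (0 : ℝ)..2 * Real.pi,
        h (circleMap 0 1 θ • u) * Complex.ofReal (Real.exp (-‖u‖ ^ 2)) := by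
    refine intervalIntegral_integral_swap ?_
    have : IsFiniteMeasure (volume.restrict (Set.uIoc 0 (2 * Real.pi))) := by
      unfold Set.uIoc
      infer_instance
    have hdom : Integrable (fun p : ℝ × CSp d =>
        (fun _ : ℝ => C) p.1 * (fun u => Real.exp (-(1 - a) * ‖u‖ ^ 2)) p.2)
        ((volume.restrict (Set.uIoc 0 (2 * Real.pi))).prod volume) :=
      Integrable.mul_prod (integrable_const C)
        (integrable_exp_neg_mul_sq_norm d (sub_pos.2 ha))
    refine hdom.mono' (Continuous.aestronglyMeasurable ?_) (.of_forall fun p => ?_)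
    · simp only [Function.uncurry_def]
      fun_prop
    · simp only [Function.uncurry, norm_mul, Complex.norm_real]
      rw [Real.norm_of_nonneg (Real.exp_nonneg _)]
      have hb := hbound (circleMap 0 1 p.1 • p.2)
      simp only [norm_smul, norm_circleMap_zero, abs_one, one_mul] at hb
      calc _ ≤ C * Real.exp (a * ‖p.2‖ ^ 2) * Real.exp (-‖p.2‖ ^ 2) := by gcongr
        _ = _ := by
          rw [mul_assoc, ← Real.exp_add]
          ring_nf
  simp only [hrot, intervalIntegral.integral_const, intervalIntegral.integral_mul_const, hmean,
    integral_const_mul, integral_complex_ofReal, integral_exp_neg_sq_norm, sub_zero] at hswap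
  rw [smul_mul_assoc] at hswap
  exact smul_right_injective ℂ (by positivity : (2 * Real.pi : ℝ) ≠ 0) hswap

/-- Entire functions of growth at most `e^{|z|²/8}` are reproduced by the Bargmann projection. -/
lemma PiA_eq_self {d : ℕ} {G : CSp d → ℂ} (hG : Differentiable ℂ G) {C : ℝ}
    (hbound : ∀ z, ‖G z‖ ≤ C * Real.exp (1 / 8 * ‖z‖ ^ 2)) : PiA d G = G := by
  have hC : 0 ≤ C := by simpa using (norm_nonneg _).trans (hbound 0)
  funext z
  have hmean := integral_mul_exp_neg_sq_norm_of_differentiable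
    (h := fun u => G (z + u) * Complex.exp (pairB u (-z)))
    (hh := by have := differentiable_pairB_left (-z); fun_prop)
    (C := C * Real.exp (1 / 4 * ‖z‖ ^ 2) * Real.exp (‖z‖ ^ 2)) (a := 1 / 2) (by norm_num)
    (fun u => by
      have h1 : ‖z + u‖ ^ 2 ≤ 2 * ‖z‖ ^ 2 + 2 * ‖u‖ ^ 2 := by
        nlinarith [norm_add_le z u, norm_nonneg (z + u), sq_nonneg (‖z‖ - ‖u‖)]
      have h2 := norm_exp_pairB_le (a := 1 / 4) (by norm_num) u (-z)
      rw [norm_neg] at h2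
      rw [norm_mul]
      calc _ ≤ C * Real.exp (1 / 8 * (2 * ‖z‖ ^ 2 + 2 * ‖u‖ ^ 2)) *
            Real.exp (1 / 4 * ‖u‖ ^ 2 + ‖z‖ ^ 2 / (4 * (1 / 4))) := by
            gcongr
            exact (hbound _).trans (by gcongr)
        _ = _ := by
          simp only [mul_assoc, ← Real.exp_add]
          ring_nf)
  unfold PiA
  rw [← integral_add_left_eq_self _ z]
  have hpt (u : CSp d) : G (z + u) * Complex.exp (pairB z (z + u)) *
      Complex.ofReal (gaussW d (z + u)) = ((Real.pi ^ d)⁻¹ : ℝ) *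
      (G (z + u) * Complex.exp (pairB u (-z)) * Complex.ofReal (Real.exp (-‖u‖ ^ 2))) := by
    have hneg : pairB u (-z) = -pairB u z := by simp [pairB]
    have hexp : Complex.exp (pairB z (z + u)) * Complex.ofReal (Real.exp (-‖z + u‖ ^ 2)) =
        Complex.exp (pairB u (-z)) * Complex.ofReal (Real.exp (-‖u‖ ^ 2)) := by
      rw [Complex.ofReal_exp, Complex.ofReal_exp, ← Complex.exp_add, ← Complex.exp_add,
        Complex.ofReal_neg, Complex.ofReal_neg, ← pairB_self, ← pairB_self, hneg]
      simp only [pairB_add_left, pairB_add_right]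
      ring_nf
    rw [mul_assoc (G _) (Complex.exp (pairB u (-z))), ← hexp, gaussW]
    push_cast
    ring
  simp only [hpt]
  rw [integral_const_mul, hmean]
  have hpi : (Real.pi : ℂ) ≠ 0 := by exact_mod_cast Real.pi_ne_zero
  simp [pairB]
  field_simp

lemma pow_le_mul_exp_sq {ε : ℝ} (hε : 0 < ε) (n : ℕ) (x : ℝ) :
    x ^ n ≤ (1 + n.factorial / ε ^ n) * Real.exp (ε * x ^ 2) := by
  have h1 : x ^ n ≤ 1 + (x ^ 2) ^ n := by
    rw [pow_right_comm]
    nlinarith [sq_nonneg (x ^ n - 1), sq_nonneg (x ^ n)]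
  have h2 := Real.pow_div_factorial_le_exp (ε * x ^ 2) (by positivity) n
  have h3 : (x ^ 2) ^ n ≤ n.factorial / ε ^ n * Real.exp (ε * x ^ 2) := by
    rw [div_le_iff₀ (by positivity), mul_pow] at h2
    rw [div_mul_eq_mul_div, le_div_iff₀ (by positivity)]
    linarith
  have h4 : 1 ≤ Real.exp (ε * x ^ 2) := Real.one_le_exp (by positivity)
  linarith

lemma IsAnalyticPoly.differentiable {d : ℕ} {G : CSp d → ℂ} (hG : IsAnalyticPoly G) :
    Differentiable ℂ G := by
  obtain ⟨s, c, h⟩ := hG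
  rw [funext h]
  fun_prop

lemma IsAnalyticPoly.exists_norm_le {d : ℕ} {G : CSp d → ℂ} (hG : IsAnalyticPoly G) {ε : ℝ}
    (hε : 0 < ε) : ∃ C, ∀ z, ‖G z‖ ≤ C * Real.exp (ε * ‖z‖ ^ 2) := by
  obtain ⟨s, c, h⟩ := hG
  refine ⟨∑ α ∈ s, ‖c α‖ * (1 + (∑ j, α j).factorial / ε ^ (∑ j, α j)), fun z => ?_⟩
  rw [h, Finset.sum_mul]
  refine norm_sum_le_of_le _ fun α _ => ?_
  rw [norm_mul, norm_prod, mul_assoc]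
  gcongr
  refine le_trans ?_ (pow_le_mul_exp_sq hε _ ‖z‖)
  rw [← Finset.prod_pow_eq_pow_sum]
  refine Finset.prod_le_prod (fun _ _ => norm_nonneg _) fun j _ => ?_
  rw [norm_pow]
  gcongr
  exact PiLp.norm_apply_le z j

lemma norm_mul_exp_pairB_mul_gaussW_le {d : ℕ} {γ : ℝ} (hγ : γ < 1) (F : CSp d → ℂ)
    (z w : CSp d) :
    ‖F w * Complex.exp (pairB z w) * Complex.ofReal (gaussW d w)‖ ≤
      (Real.pi ^ d)⁻¹ * Real.exp (1 / (4 * (1 - γ)) * ‖z‖ ^ 2) *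
        (‖F w‖ * Real.exp (-(γ * ‖w‖ ^ 2))) := by
  have hγ' : 0 < 1 - γ := sub_pos.2 hγ
  have hk := norm_exp_pairB_le (a := 1 / (4 * (1 - γ))) (by positivity) z w
  rw [norm_mul, norm_mul, Complex.norm_real, Real.norm_of_nonneg (gaussW_nonneg w), gaussW]
  have hexp : Real.exp (1 / (4 * (1 - γ)) * ‖z‖ ^ 2 + ‖w‖ ^ 2 / (4 * (1 / (4 * (1 - γ))))) *
      Real.exp (-‖w‖ ^ 2) =
      Real.exp (1 / (4 * (1 - γ)) * ‖z‖ ^ 2) * Real.exp (-(γ * ‖w‖ ^ 2)) := by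
    rw [← Real.exp_add, ← Real.exp_add]
    congr 1
    field_simp
    ring
  calc _ ≤ ‖F w‖ * Real.exp (1 / (4 * (1 - γ)) * ‖z‖ ^ 2 + ‖w‖ ^ 2 / (4 * (1 / (4 * (1 - γ))))) *
        ((Real.pi ^ d)⁻¹ * Real.exp (-‖w‖ ^ 2)) := by gcongr
    _ = ‖F w‖ * (Real.pi ^ d)⁻¹ *
        (Real.exp (1 / (4 * (1 - γ)) * ‖z‖ ^ 2 + ‖w‖ ^ 2 / (4 * (1 / (4 * (1 - γ))))) *
          Real.exp (-‖w‖ ^ 2)) := by ring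
    _ = _ := by
      rw [hexp]
      ring

lemma integrable_mul_exp_pairB_mul_gaussW {d : ℕ} {γ : ℝ} (hγ : γ < 1) {F : CSp d → ℂ}
    (hF : AEStronglyMeasurable F)
    (hint : Integrable (fun z => ‖F z‖ * Real.exp (-(γ * ‖z‖ ^ 2)))) (z : CSp d) :
    Integrable (fun w => F w * Complex.exp (pairB z w) * Complex.ofReal (gaussW d w)) := by
  refine (hint.const_mul _).mono' ?_
    (.of_forall fun w => norm_mul_exp_pairB_mul_gaussW_le hγ F z w)
  have h1 : Continuous (fun w => pairB z w) := continuous_pairB.comp (Continuous.prodMk_right z)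
  have h2 := continuous_gaussW d
  exact (hF.mul (by fun_prop)).mul (by fun_prop)

lemma integrable_mul_conj_mul_gaussW {d : ℕ} {γ : ℝ} {F G : CSp d → ℂ}
    (hF : AEStronglyMeasurable F)
    (hint : Integrable (fun z => ‖F z‖ * Real.exp (-(γ * ‖z‖ ^ 2))))
    (hG : Continuous G) {C : ℝ} (hbound : ∀ z, ‖G z‖ ≤ C * Real.exp ((1 - γ) * ‖z‖ ^ 2)) :
    Integrable (fun z => F z * (starRingEnd ℂ) (G z) * Complex.ofReal (gaussW d z)) := by
  have h2 := continuous_gaussW d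
  refine (hint.const_mul (C * (Real.pi ^ d)⁻¹)).mono' ((hF.mul (by fun_prop)).mul (by fun_prop))
    (.of_forall fun w => ?_)
  rw [norm_mul, norm_mul, Complex.norm_real, Real.norm_of_nonneg (gaussW_nonneg w), gaussW,
    RCLike.norm_conj]
  calc _ ≤ ‖F w‖ * (C * Real.exp ((1 - γ) * ‖w‖ ^ 2)) *
        ((Real.pi ^ d)⁻¹ * Real.exp (-‖w‖ ^ 2)) := by gcongr; exact hbound w
    _ = C * (Real.pi ^ d)⁻¹ * (‖F w‖ * (Real.exp ((1 - γ) * ‖w‖ ^ 2) * Real.exp (-‖w‖ ^ 2))) := by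
      ring
    _ = _ := by
      rw [← Real.exp_add]
      ring_nf

/-- The Bargmann kernel paired with `F` and `G` is integrable on the product space. -/
lemma integrable_bargmann_kernel_prod {d : ℕ} {γ : ℝ} (hγ : γ < 3 / 4) {F G : CSp d → ℂ}
    (hF : AEStronglyMeasurable F)
    (hint : Integrable (fun z => ‖F z‖ * Real.exp (-(γ * ‖z‖ ^ 2))))
    (hG : Continuous G)
    (hbound : ∀ ε : ℝ, 0 < ε → ∃ C, ∀ z, ‖G z‖ ≤ C * Real.exp (ε * ‖z‖ ^ 2)) :
    Integrable (fun p : CSp d × CSp d =>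
      F p.2 * Complex.exp (pairB p.1 p.2) * Complex.ofReal (gaussW d p.2) *
        ((starRingEnd ℂ) (G p.1) * Complex.ofReal (gaussW d p.1))) (volume.prod volume) := by
  have hγ' : 0 < 1 - γ := by linarith
  set a : ℝ := 1 / (4 * (1 - γ)) with ha
  have ha1 : 0 < 1 - a := by
    rw [ha, sub_pos, div_lt_one (by positivity)]
    linarith
  obtain ⟨C, hC⟩ := hbound ((1 - a) / 2) (by positivity)
  have hGint := (integrable_mul_exp_neg_sq_norm hG (by linarith : (1 - a) / 2 < 1 - a) hC).norm
  have hdom := (hGint.mul_prod hint).const_mul ((Real.pi ^ d)⁻¹ * (Real.pi ^ d)⁻¹)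
  have h1 := continuous_pairB (d := d)
  have h2 := continuous_gaussW d
  refine hdom.mono' (((hF.comp_snd.mul (by fun_prop)).mul (by fun_prop)).mul (by fun_prop))
    (.of_forall fun p => ?_)
  have hk := norm_mul_exp_pairB_mul_gaussW_le (by linarith : γ < 1) F p.1 p.2
  rw [← ha] at hk
  rw [norm_mul _ (_ * _), norm_mul ((starRingEnd ℂ) _), RCLike.norm_conj, Complex.norm_real,
    Real.norm_of_nonneg (gaussW_nonneg p.1), norm_mul (G _), Complex.norm_real,
    Real.norm_of_nonneg (Real.exp_nonneg _)]
  have hexp : Real.exp (-(1 - a) * ‖p.1‖ ^ 2) =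
      Real.exp (a * ‖p.1‖ ^ 2) * Real.exp (-‖p.1‖ ^ 2) := by
    rw [← Real.exp_add]
    ring_nf
  refine (mul_le_mul_of_nonneg_right hk
    (mul_nonneg (norm_nonneg _) (gaussW_nonneg _))).trans_eq ?_
  rw [hexp, gaussW]
  ring

lemma BPair_PiA_left {d : ℕ} {F G : CSp d → ℂ}
    (hint : Integrable (fun p : CSp d × CSp d =>
      F p.2 * Complex.exp (pairB p.1 p.2) * Complex.ofReal (gaussW d p.2) *
        ((starRingEnd ℂ) (G p.1) * Complex.ofReal (gaussW d p.1))) (volume.prod volume)) :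
    BPair (PiA d F) G = BPair F (PiA d G) := by
  have hswap := integral_integral_swap (f := fun z w : CSp d =>
      F w * Complex.exp (pairB z w) * Complex.ofReal (gaussW d w) *
        ((starRingEnd ℂ) (G z) * Complex.ofReal (gaussW d z))) hint
  unfold BPair PiA
  simp only [integral_mul_const] at hswap
  simp only [mul_assoc] at hswap ⊢
  rw [hswap]
  congr 1 with w
  rw [← integral_conj, ← integral_mul_const, ← integral_const_mul]
  congr 1 with z
  simp only [map_mul, ← Complex.exp_conj, conj_pairB, Complex.conj_ofReal]
  ring

/-- if `γ ∈ (0,3/4)` and `∫ |F| e^{−γ|z|²} dλ < ∞`, then for every analytic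
polynomial `G` all the pairings are absolutely convergent and
`(F,G)_{B²} = (F, Π_A G)_{B²} = (Π_A F, G)_{B²}`. -/
theorem stmt7 (d : ℕ) (hd : 1 ≤ d) (γ : ℝ) (hγ0 : 0 < γ) (hγ : γ < 3 / 4)
    (F : CSp d → ℂ) (hF : LocallyIntegrable F volume)
    (hint : (∫⁻ z : CSp d, ENNReal.ofReal (‖F z‖ * Real.exp (-(γ * ‖z‖ ^ 2)))) < ⊤)
    (G : CSp d → ℂ) (hG : IsAnalyticPoly G) :
    (∀ z : CSp d, Integrable
      (fun w => F w * Complex.exp (pairB z w) * Complex.ofReal (gaussW d w)) volume) ∧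
    (∀ z : CSp d, Integrable
      (fun w => G w * Complex.exp (pairB z w) * Complex.ofReal (gaussW d w)) volume) ∧
    Integrable (fun z : CSp d =>
      F z * (starRingEnd ℂ) (G z) * Complex.ofReal (gaussW d z)) volume ∧
    Integrable (fun z : CSp d =>
      F z * (starRingEnd ℂ) (PiA d G z) * Complex.ofReal (gaussW d z)) volume ∧
    Integrable (fun z : CSp d =>
      PiA d F z * (starRingEnd ℂ) (G z) * Complex.ofReal (gaussW d z)) volume ∧
    BPair F G = BPair F (PiA d G) ∧ BPair F G = BPair (PiA d F) G := by
  have hγ1 : γ < 1 := by linarith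
  have hFm : AEStronglyMeasurable F := hF.aestronglyMeasurable
  have hFint : Integrable (fun z => ‖F z‖ * Real.exp (-(γ * ‖z‖ ^ 2))) := by
    refine ⟨hFm.norm.mul (by fun_prop), ?_⟩
    rwa [hasFiniteIntegral_iff_ofReal (.of_forall fun z => by positivity)]
  have hGd := hG.differentiable
  obtain ⟨C, hC⟩ := hG.exists_norm_le (ε := 1 / 8) (by norm_num)
  obtain ⟨C', hC'⟩ := hG.exists_norm_le (sub_pos.2 hγ1)
  have hGint : Integrable (fun z => ‖G z‖ * Real.exp (-(1 / 2 * ‖z‖ ^ 2))) := by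
    refine (integrable_mul_exp_neg_sq_norm hGd.continuous (b := 1 / 2) (by norm_num)
      hC).norm.congr (.of_forall fun z => ?_)
    simp only [norm_mul, Complex.norm_real, Real.norm_of_nonneg (Real.exp_nonneg _), neg_mul]
  have hPi := PiA_eq_self hGd hC
  have hFG := integrable_mul_conj_mul_gaussW hFm hFint hGd.continuous hC'
  have hK := integrable_bargmann_kernel_prod hγ hFm hFint hGd.continuous
    fun ε hε => hG.exists_norm_le hε
  refine ⟨integrable_mul_exp_pairB_mul_gaussW hγ1 hFm hFint,
    integrable_mul_exp_pairB_mul_gaussW (by norm_num) hGd.continuous.aestronglyMeasurable hGint,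
    hFG, by rwa [hPi], ?_, by rw [hPi], by rw [BPair_PiA_left hK, hPi]⟩
  have hleft := hK.integral_prod_left
  simp only [integral_mul_const] at hleft
  simpa only [PiA, mul_assoc] using hleft
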